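/- Let P be a noiseless, finitely supported probability distribution on 𝒳 × {-1,1}. A model f : 𝒳 → [-1,1] is a lossless maximal compressor of P (i.e., I_P(f(X);X) = I_P(f(X);Y) = I_P(X;Y)) if and only if there exists an injective map g : [-1,1] → ℝ such that g ∘ f is a margin maximizer with respect to P, i.e., y · g(f(x)) = 1 for every (x,y) with P(x,y) > 0. -/

import Mathlib

open Finset

noncomputable section

/-- The binary label space `𝒴 = {-1, 1} ⊆ ℤ`. -/
abbrev Ybin : Type := ({-1, 1} : Finset ℤ)

/-- The label `+1` as an element of `Ybin`. -/
def yPos : Ybin := ⟨1, by decide⟩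

/-- The label `-1` as an element of `Ybin`. -/
def yNeg : Ybin := ⟨-1, by decide⟩

/-- Probability of a set under a finitely supported pmf `P`. -/
def pr {Ω : Type*} [Fintype Ω] (P : Ω → ℝ) (s : Set Ω) : ℝ :=
  ∑ ω, s.indicator P ω

/-- Entropy `H_P(A)` of a random variable `A` (a function of the sample point),
`H_P(A) = -∑_a P(A=a) log P(A=a)`, written as a sum over sample points. -/
def ent {Ω α : Type*} [Fintype Ω] (P : Ω → ℝ) (A : Ω → α) : ℝ :=
  -∑ ω, P ω * Real.log (pr P {ω' | A ω' = A ω})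

/-- Conditional entropy `H_P(A|B) = -∑_{a,b} P(A=a,B=b) log P(A=a|B=b)`. -/
def condEnt {Ω α β : Type*} [Fintype Ω] (P : Ω → ℝ) (A : Ω → α) (B : Ω → β) : ℝ :=
  -∑ ω, P ω * Real.log (pr P {ω' | A ω' = A ω ∧ B ω' = B ω} / pr P {ω' | B ω' = B ω})

/-- Mutual information `I_P(A;B) = ∑_{a,b} P(A=a,B=b) log (P(A=a,B=b) / (P(A=a) P(B=b)))`. -/
def mi {Ω α β : Type*} [Fintype Ω] (P : Ω → ℝ) (A : Ω → α) (B : Ω → β) : ℝ :=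
  ∑ ω, P ω * Real.log (pr P {ω' | A ω' = A ω ∧ B ω' = B ω} /
      (pr P {ω' | A ω' = A ω} * pr P {ω' | B ω' = B ω}))

/-- Marginal `P_X(x) = ∑_y P(x,y)`. -/
def margX {𝒳 : Type*} [Fintype 𝒳] (P : 𝒳 × Ybin → ℝ) (x : 𝒳) : ℝ :=
  ∑ y, P (x, y)

/-- Risk `R_P(h) = P[sign(h(X)) ≠ Y]`. -/
def risk {𝒳 : Type*} [Fintype 𝒳] (P : 𝒳 × Ybin → ℝ) (h : 𝒳 → ℝ) : ℝ :=
  pr P {ω | Real.sign (h ω.1) ≠ ((ω.2 : ℤ) : ℝ)}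

section Information

variable {Ω α β : Type*} [Fintype Ω] {P : Ω → ℝ}

lemma pr_mono (hP : ∀ ω, 0 ≤ P ω) {s t : Set Ω} (hst : s ⊆ t) : pr P s ≤ pr P t :=
  sum_le_sum fun ω _ => Set.indicator_le_indicator_of_subset hst hP ω

lemma pr_nonneg (hP : ∀ ω, 0 ≤ P ω) (s : Set Ω) : 0 ≤ pr P s :=
  sum_nonneg fun ω _ => Set.indicator_nonneg (fun ω _ => hP ω) ω

lemma pr_pos (hP : ∀ ω, 0 ≤ P ω) {s : Set Ω} {ω : Ω} (hs : ω ∈ s) (hω : 0 < P ω) :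
    0 < pr P s :=
  sum_pos' (fun ω _ => Set.indicator_nonneg (fun ω _ => hP ω) ω)
    ⟨ω, mem_univ ω, by rwa [Set.indicator_of_mem hs]⟩

lemma pr_eq_pr_iff_of_subset (hP : ∀ ω, 0 ≤ P ω) {s t : Set Ω} (hst : s ⊆ t) :
    pr P s = pr P t ↔ ∀ ω ∈ t, 0 < P ω → ω ∈ s := by
  classical
  unfold pr
  rw [sum_eq_sum_iff_of_le fun ω _ => Set.indicator_le_indicator_of_subset hst hP ω]
  refine ⟨fun h ω ht hω => ?_, fun h ω _ => ?_⟩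
  · by_contra hs
    have := h ω (mem_univ ω)
    rw [Set.indicator_of_notMem hs, Set.indicator_of_mem ht] at this
    exact hω.ne this
  · by_cases hs : ω ∈ s
    · rw [Set.indicator_of_mem hs, Set.indicator_of_mem (hst hs)]
    · rw [Set.indicator_of_notMem hs]
      by_cases ht : ω ∈ t
      · rw [Set.indicator_of_mem ht]
        exact (hP ω).eq_of_not_lt fun hω => hs (h ω ht hω)
      · rw [Set.indicator_of_notMem ht]

lemma mi_comm (A : Ω → α) (B : Ω → β) : mi P A B = mi P B A := by
  simp only [mi, and_comm, mul_comm]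

lemma mi_eq_ent_sub_condEnt (hP : ∀ ω, 0 ≤ P ω) (A : Ω → α) (B : Ω → β) :
    mi P A B = ent P A - condEnt P A B := by
  rw [mi, ent, condEnt, neg_sub_neg, ← sum_sub_distrib]
  refine sum_congr rfl fun ω _ => ?_
  rcases (hP ω).eq_or_lt with h | h
  · simp [← h]
  · have hAB : 0 < pr P {ω' | A ω' = A ω ∧ B ω' = B ω} := pr_pos hP ⟨rfl, rfl⟩ h
    have hA : 0 < pr P {ω' | A ω' = A ω} := pr_pos hP rfl h
    have hB : 0 < pr P {ω' | B ω' = B ω} := pr_pos hP rfl h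
    rw [Real.log_div hAB.ne' (mul_pos hA hB).ne', Real.log_mul hA.ne' hB.ne',
      Real.log_div hAB.ne' hB.ne']
    ring

/-- `H_P(A|B) = 0` iff `A` is a function of `B` on the support of `P`. -/
lemma condEnt_eq_zero_iff (hP : ∀ ω, 0 ≤ P ω) (A : Ω → α) (B : Ω → β) :
    condEnt P A B = 0 ↔ ∀ ω ω', 0 < P ω → 0 < P ω' → B ω' = B ω → A ω' = A ω := by
  have hsub (ω : Ω) : {ω' | A ω' = A ω ∧ B ω' = B ω} ⊆ {ω' | B ω' = B ω} := fun _ h => h.2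
  have hlog (ω : Ω) :
      Real.log (pr P {ω' | A ω' = A ω ∧ B ω' = B ω} / pr P {ω' | B ω' = B ω}) ≤ 0 :=
    Real.log_nonpos (div_nonneg (pr_nonneg hP _) (pr_nonneg hP _))
      (div_le_one_of_le₀ (pr_mono hP (hsub ω)) (pr_nonneg hP _))
  rw [condEnt, neg_eq_zero,
    sum_eq_zero_iff_of_nonpos fun ω _ => mul_nonpos_of_nonneg_of_nonpos (hP ω) (hlog ω)]
  refine forall_congr' fun ω => ?_
  rcases (hP ω).eq_or_lt with h | h
  · simp [← h]
  have hAB : 0 < pr P {ω' | A ω' = A ω ∧ B ω' = B ω} := pr_pos hP ⟨rfl, rfl⟩ h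
  have hB : 0 < pr P {ω' | B ω' = B ω} := pr_pos hP rfl h
  have key := pr_eq_pr_iff_of_subset hP (hsub ω)
  simp only [Set.mem_ofPred_eq] at key
  constructor
  · intro h0 ω' _ hω' hb
    have h1 := Real.eq_one_of_pos_of_log_eq_zero (div_pos hAB hB)
      ((mul_eq_zero.1 (h0 (mem_univ ω))).resolve_left h.ne')
    exact (key.1 ((div_eq_one_iff_eq hB.ne').1 h1) ω' hb hω').1
  · intro h0 _
    rw [key.2 fun ω' hb hω' => ⟨h0 ω' h hω' hb, hb⟩, div_self hB.ne', Real.log_one, mul_zero]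

end Information

lemma Ybin.cast_mul_self (y : Ybin) : ((y : ℤ) : ℝ) * ((y : ℤ) : ℝ) = 1 := by
  obtain ⟨y, hy⟩ := y
  simp only [mem_insert, mem_singleton] at hy
  rcases hy with rfl | rfl <;> norm_num

lemma Ybin.coe_eq_neg_of_ne {y z : Ybin} (h : y ≠ z) : (y : ℤ) = -(z : ℤ) := by
  revert y z; decide

/-- If `F` and `Y` determine each other on the support of `P`, then an injective (affine)
reparametrization of `F` agrees with `Y` there. -/
lemma exists_injective_margin_of_equivalent {Ω : Type*} [Fintype Ω] {P : Ω → ℝ}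
    (hP1 : ∑ ω, P ω = 1) (F : Ω → ℝ) (Y : Ω → Ybin)
    (hFY : ∀ ω ω', 0 < P ω → 0 < P ω' → Y ω' = Y ω → F ω' = F ω)
    (hYF : ∀ ω ω', 0 < P ω → 0 < P ω' → F ω' = F ω → Y ω' = Y ω) :
    ∃ g : ℝ → ℝ, g.Injective ∧ ∀ ω, 0 < P ω → ((Y ω : ℤ) : ℝ) * g (F ω) = 1 := by
  obtain ⟨ω₀, -, h₀⟩ : ∃ ω ∈ univ, 0 < P ω :=
    exists_lt_of_sum_lt (by simp [hP1])
  obtain ⟨b, hb, hFb⟩ : ∃ b, F ω₀ ≠ b ∧ ∀ ω, 0 < P ω → Y ω ≠ Y ω₀ → F ω = b := by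
    by_cases h : ∃ ω, 0 < P ω ∧ Y ω ≠ Y ω₀
    · obtain ⟨ω₁, h₁, hY⟩ := h
      refine ⟨F ω₁, fun h => hY (hYF ω₀ ω₁ h₀ h₁ h.symm), fun ω hω hne => ?_⟩
      refine hFY ω₁ ω h₁ hω (Subtype.ext ?_)
      rw [Ybin.coe_eq_neg_of_ne hne, Ybin.coe_eq_neg_of_ne hY]
    · push Not at h
      exact ⟨F ω₀ + 1, by simp, fun ω hω hne => absurd (h ω hω) hne⟩
  have hsq := Ybin.cast_mul_self (Y ω₀)
  have hd : F ω₀ - b ≠ 0 := sub_ne_zero.2 hb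
  refine ⟨fun t => ((Y ω₀ : ℤ) : ℝ) * (2 * ((t - b) / (F ω₀ - b)) - 1), fun s t hst => ?_,
    fun ω hω => ?_⟩
  · have hy : ((Y ω₀ : ℤ) : ℝ) ≠ 0 := left_ne_zero_of_mul_eq_one hsq
    have h := mul_left_cancel₀ hy hst
    field_simp at h
    linarith
  · by_cases hY : Y ω = Y ω₀
    · simp only [hFY ω₀ ω h₀ hω hY, hY, div_self hd]
      linarith
    · simp only [hFb ω hω hY, Ybin.coe_eq_neg_of_ne hY, sub_self, zero_div]
      push_cast
      linarith

/-- Let `P` be noiseless. A model `f : 𝒳 → [-1,1]` is a lossless maximal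
compressor of `P` (`I_P(F;X) = I_P(F;Y) = I_P(X;Y)`) iff there is an injective map
`g : [-1,1] → ℝ` such that `g ∘ f` is a margin maximizer w.r.t. `P`, i.e.
`y · g(f(x)) = 1` for every `(x,y)` with `P(x,y) > 0`. -/
theorem lmc_iff_exists_invertible_margin_maximizer {𝒳 : Type*} [Fintype 𝒳]
    (P : 𝒳 × Ybin → ℝ) (hP0 : ∀ ω, 0 ≤ P ω) (hP1 : ∑ ω, P ω = 1)
    (hnoiseless : condEnt P (fun ω => ω.2) (fun ω => ω.1) = 0)
    (f : 𝒳 → ℝ) (hf : ∀ x, f x ∈ Set.Icc (-1 : ℝ) 1) :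
    (mi P (fun ω => f ω.1) (fun ω => ω.1) = mi P (fun ω => f ω.1) (fun ω => ω.2) ∧
        mi P (fun ω => f ω.1) (fun ω => ω.2) = mi P (fun ω => ω.1) (fun ω => ω.2)) ↔
      ∃ g : ℝ → ℝ, Set.InjOn g (Set.Icc (-1 : ℝ) 1) ∧
        ∀ ω : 𝒳 × Ybin, 0 < P ω → ((ω.2 : ℤ) : ℝ) * g (f ω.1) = 1 := by
  have hFX : condEnt P (fun ω => f ω.1) (fun ω => ω.1) = 0 :=
    (condEnt_eq_zero_iff hP0 _ _).2 fun _ _ _ _ h => congrArg f h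
  rw [mi_eq_ent_sub_condEnt hP0 (fun ω => f ω.1) (fun ω => ω.1), hFX, sub_zero,
    mi_comm (fun ω : 𝒳 × Ybin => ω.1) (fun ω => ω.2),
    mi_eq_ent_sub_condEnt hP0 (fun ω => ω.2) (fun ω => ω.1), hnoiseless, sub_zero]
  have hcompress : ent P (fun ω => f ω.1) = mi P (fun ω => f ω.1) (fun ω => ω.2) ↔
      condEnt P (fun ω => f ω.1) (fun ω => ω.2) = 0 := by
    rw [mi_eq_ent_sub_condEnt hP0, eq_comm, sub_eq_self]
  have hlossless : mi P (fun ω => f ω.1) (fun ω => ω.2) = ent P (fun ω => ω.2) ↔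
      condEnt P (fun ω => ω.2) (fun ω => f ω.1) = 0 := by
    rw [mi_comm, mi_eq_ent_sub_condEnt hP0, sub_eq_self]
  rw [hcompress, hlossless, condEnt_eq_zero_iff hP0, condEnt_eq_zero_iff hP0]
  constructor
  · rintro ⟨hFY, hYF⟩
    obtain ⟨g, hg, hm⟩ := exists_injective_margin_of_equivalent hP1 _ _ hFY hYF
    exact ⟨g, hg.injOn, hm⟩
  · rintro ⟨g, hg, hm⟩
    have hgy (ω : 𝒳 × Ybin) (hω : 0 < P ω) : g (f ω.1) = ((ω.2 : ℤ) : ℝ) :=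
      mul_left_cancel₀ (left_ne_zero_of_mul_eq_one (hm ω hω))
        ((hm ω hω).trans (Ybin.cast_mul_self ω.2).symm)
    refine ⟨fun ω ω' hω hω' h => hg (hf _) (hf _) ?_, fun ω ω' hω hω' h => Subtype.ext ?_⟩
    · rw [hgy ω hω, hgy ω' hω', h]
    · have h' : ((ω'.2 : ℤ) : ℝ) = ((ω.2 : ℤ) : ℝ) := by
        rw [← hgy ω hω, ← hgy ω' hω', h]
      exact_mod_cast h'
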